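/- Let S be a topological semigroup acting non-expansively on a metric space (X,d). Then the following are equivalent: (1) there exists a real Banach space V, equipped with a linear non-expansive action of S, and an equivariant isometric embedding of (X,d) into V; (2) every orbit S·x of S in X is a bounded set. -/

import Mathlib

open Bornology Metric Set

universe u v

/-- A non-expansive (jointly continuous) action of a topological semigroup `S`
on a metric space `X`. -/
structure NonexpAction (S : Type*) (X : Type*) [Semigroup S] [TopologicalSpace S]
    [MetricSpace X] where
  act : S → X → X
  mul_act : ∀ s t x, act (s * t) x = act s (act t x)
  nonexp : ∀ s x y, dist (act s x) (act s y) ≤ dist x y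
  cont : Continuous fun p : S × X => act p.1 p.2

/-- A linear non-expansive (jointly continuous) action of a topological semigroup `S`
on a real normed space `V`. -/
structure LinNonexpAction (S : Type*) (V : Type*) [Semigroup S] [TopologicalSpace S]
    [NormedAddCommGroup V] [NormedSpace ℝ V] where
  act : S → V → V
  mul_act : ∀ s t x, act (s * t) x = act s (act t x)
  linear : ∀ s, IsLinearMap ℝ (act s)
  nonexp : ∀ s x, ‖act s x‖ ≤ ‖x‖
  cont : Continuous fun p : S × V => act p.1 p.2

theorem exists_rho {S : Type u} {X : Type v} [Semigroup S] [TopologicalSpace S]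
    [MetricSpace X] (π : NonexpAction S X)
    (hb : ∀ x : X, IsBounded (range fun s => π.act s x)) :
    ∃ ρ : X → ℝ, (∀ x y, ρ x ≤ ρ y + dist x y) ∧ (∀ s x, ρ (π.act s x) ≤ ρ x) ∧
      ∀ x y, dist x y ≤ ρ x + ρ y := by
  rcases isEmpty_or_nonempty X with hX | ⟨⟨x₀⟩⟩
  · exact ⟨fun _ => 0, fun x => (hX.false x).elim, fun _ x => (hX.false x).elim,
      fun x => (hX.false x).elim⟩
  let a : Option S → X → X := fun o x => o.elim x (fun s => π.act s x)
  have hbd : ∀ x, BddAbove (range fun o => dist (a o x) x₀) := by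
    intro x
    obtain ⟨C, hC⟩ := (hb x).subset_closedBall x₀
    refine ⟨max C (dist x x₀), ?_⟩
    rintro _ ⟨o, rfl⟩
    cases o with
    | none => exact le_max_right _ _
    | some s => exact (mem_closedBall.1 (hC ⟨s, rfl⟩)).trans (le_max_left _ _)
  have ha : ∀ o x y, dist (a o x) (a o y) ≤ dist x y := by
    intro o x y
    cases o with
    | none => exact le_rfl
    | some s => exact π.nonexp s x y
  have h0 : ∀ x, dist x x₀ ≤ ⨆ o, dist (a o x) x₀ := fun x => le_ciSup (hbd x) none
  refine ⟨fun x => ⨆ o, dist (a o x) x₀, ?_, ?_, ?_⟩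
  · intro x y
    refine ciSup_le fun o => ?_
    have h1 := le_ciSup (hbd y) o
    have h2 := ha o x y
    have h3 := dist_triangle (a o x) (a o y) x₀
    linarith
  · intro s x
    refine ciSup_le fun o => ?_
    cases o with
    | none => exact le_ciSup (hbd x) (some s)
    | some t =>
      have h := le_ciSup (hbd x) (some (t * s))
      simpa only [a, Option.elim, π.mul_act] using h
  · intro x y
    have h1 := h0 x
    have h2 := h0 y
    have h3 := dist_triangle_right x y x₀
    linarith

/-- The test functions: 1-Lipschitz functions dominated by `ρ`. -/
def TestFun {X : Type v} [MetricSpace X] (ρ : X → ℝ) : Type (max u v) :=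
  ULift.{u} {φ : X → ℝ // (∀ x y, φ x - φ y ≤ dist x y) ∧ ∀ x, |φ x| ≤ ρ x}

instance {X : Type v} [MetricSpace X] (ρ : X → ℝ) : TopologicalSpace (TestFun.{u, v} ρ) := ⊥

instance {X : Type v} [MetricSpace X] (ρ : X → ℝ) : DiscreteTopology (TestFun.{u, v} ρ) := ⟨rfl⟩

theorem stmt_3_mpr {S : Type u} {X : Type v} [Semigroup S] [TopologicalSpace S] [ContinuousMul S]
    [MetricSpace X] (π : NonexpAction S X)
    (hb : ∀ x : X, IsBounded (range fun s => π.act s x)) :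
    ∃ (V : Type (max u v)) (_ : NormedAddCommGroup V) (_ : NormedSpace ℝ V)
        (_ : CompleteSpace V) (σ : LinNonexpAction S V) (f : X → V),
        Isometry f ∧ ∀ s x, f (π.act s x) = σ.act s (f x) := by
  obtain ⟨ρ, hρ1, hρ2, hρ3⟩ := exists_rho π hb
  let Φ : Type (max u v) := TestFun.{u, v} ρ
  let W := BoundedContinuousFunction Φ ℝ
  let tr : S → Φ → Φ := fun s φ => ULift.up ⟨fun x => φ.down.1 (π.act s x),
    fun x y => (φ.down.2.1 _ _).trans (π.nonexp s x y),
    fun x => (φ.down.2.2 _).trans (hρ2 s x)⟩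
  let A : S → W → W := fun s F => F.compContinuous ⟨tr s, continuous_of_discreteTopology⟩
  have hAapp : ∀ s F φ, A s F φ = F (tr s φ) := fun _ _ _ => rfl
  have hAmul : ∀ s t F, A (s * t) F = A s (A t F) := by
    intro s t F
    ext φ
    rw [hAapp, hAapp, hAapp]
    have h : tr (s * t) φ = tr t (tr s φ) :=
      congrArg ULift.up (Subtype.ext (funext fun x => congrArg φ.down.1 (π.mul_act s t x)))
    rw [h]
  have hAadd : ∀ s F G, A s (F + G) = A s F + A s G := fun _ _ _ => rfl
  have hAsub : ∀ s F G, A s (F - G) = A s F - A s G := fun _ _ _ => rfl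
  have hAsmul : ∀ s (c : ℝ) F, A s (c • F) = c • A s F := fun _ _ _ => rfl
  have hAnorm : ∀ s F, ‖A s F‖ ≤ ‖F‖ := fun s F =>
    (BoundedContinuousFunction.norm_le (norm_nonneg _)).2 fun φ => F.norm_coe_le_norm _
  have hAdist : ∀ s F G, dist (A s F) (A s G) ≤ dist F G := by
    intro s F G
    rw [dist_eq_norm, dist_eq_norm, ← hAsub]
    exact hAnorm s _
  let ev : X → W := fun x => BoundedContinuousFunction.ofNormedAddCommGroup
    (fun φ : Φ => φ.down.1 x) continuous_of_discreteTopology (ρ x) fun φ => φ.down.2.2 x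
  have hevapp : ∀ x φ, ev x φ = φ.down.1 x := fun _ _ => rfl
  have hev : Isometry ev := by
    refine Isometry.of_dist_eq fun x y => le_antisymm ?_ ?_
    · refine (BoundedContinuousFunction.dist_le dist_nonneg).2 fun φ => ?_
      rw [hevapp, hevapp, Real.dist_eq, abs_le]
      have h1 := φ.down.2.1 x y
      have h2 := φ.down.2.1 y x
      rw [dist_comm] at h2
      constructor <;> linarith
    · let φ : Φ := ULift.up ⟨fun z => dist z y - ρ y, fun z w => by
        have := dist_triangle z w y
        linarith, fun z => by
        rw [abs_le]
        have h1 := hρ1 y z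
        have h2 := hρ3 z y
        rw [dist_comm] at h1
        constructor <;> linarith⟩
      have h := BoundedContinuousFunction.dist_coe_le_dist (f := ev x) (g := ev y) φ
      have h2 : dist (ev x φ) (ev y φ) = dist x y := by
        change |(dist x y - ρ y) - (dist y y - ρ y)| = dist x y
        simp
      rwa [h2] at h
  have hAev : ∀ s x, A s (ev x) = ev (π.act s x) := fun _ _ => rfl
  let V : Submodule ℝ W :=
    { carrier := {F | Continuous fun s => A s F}
      add_mem' := fun {F G} hF hG => by
        simp only [mem_ofPred_eq, hAadd] at *
        exact hF.add hG
      zero_mem' := by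
        have : ∀ s, A s 0 = 0 := fun _ => rfl
        simp only [mem_ofPred_eq, this]
        exact continuous_const
      smul_mem' := fun c F hF => by
        simp only [mem_ofPred_eq, hAsmul] at *
        exact hF.const_smul c }
  have hVmem : ∀ F, F ∈ V ↔ Continuous fun s => A s F := fun _ => Iff.rfl
  have hVclosed : IsClosed (V : Set W) := by
    refine isClosed_of_closure_subset fun F hF => ?_
    change Continuous fun s => A s F
    refine continuous_of_uniform_approx_of_continuous fun U hU => ?_
    obtain ⟨ε, hε, hU⟩ := Metric.mem_uniformity_dist.1 hU
    obtain ⟨G, hG, hFG⟩ := Metric.mem_closure_iff.1 hF ε hε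
    exact ⟨fun s => A s G, hG, fun s => hU ((hAdist s F G).trans_lt hFG)⟩
  have hAV : ∀ s F, F ∈ V → A s F ∈ V := by
    intro s F hF
    rw [hVmem] at *
    simp only [← hAmul]
    exact hF.comp (continuous_mul_const s)
  have hevV : ∀ x, ev x ∈ V := by
    intro x
    rw [hVmem]
    simp only [hAev]
    exact hev.continuous.comp (π.cont.comp (continuous_id.prodMk continuous_const))
  refine ⟨V, inferInstance, inferInstance, hVclosed.completeSpace_coe,
    { act := fun s F => ⟨A s F.1, hAV s _ F.2⟩
      mul_act := fun s t F => Subtype.ext (hAmul s t F.1)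
      linear := fun s => ⟨fun F G => rfl, fun c F => rfl⟩
      nonexp := fun s F => hAnorm s F.1
      cont := ?_ }, fun x => ⟨ev x, hevV x⟩, ?_, fun s x => rfl⟩
  · refine Continuous.subtype_mk ?_ _
    rw [continuous_iff_continuousAt]
    rintro ⟨s, F⟩
    rw [ContinuousAt, tendsto_iff_dist_tendsto_zero]
    have h1 : Continuous fun p : S × V => dist p.2.1 F.1 + dist (A p.1 F.1) (A s F.1) := by
      have hF : Continuous fun s => A s F.1 := F.2
      have h2 : Continuous fun p : S × V => A p.1 F.1 := hF.comp continuous_fst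
      exact ((continuous_subtype_val.comp continuous_snd).dist continuous_const).add
        (h2.dist continuous_const)
    have h2 := h1.tendsto (s, F)
    simp only [dist_self, add_zero] at h2
    refine squeeze_zero (fun _ => dist_nonneg) (fun p => ?_) h2
    exact (dist_triangle _ (A p.1 F.1) _).trans (by gcongr; exact hAdist _ _ _)
  · exact Isometry.of_dist_eq fun x y => hev.dist_eq x y

/-- A non-expansive action of a topological semigroup on a metric space is linearizable
(embeds equivariantly and isometrically into a real Banach space carrying a linear
non-expansive action) iff all its orbits are bounded. -/
theorem stmt_3 {S : Type u} {X : Type v} [Semigroup S] [TopologicalSpace S] [ContinuousMul S]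
    [MetricSpace X] (π : NonexpAction S X) :
    (∃ (V : Type (max u v)) (_ : NormedAddCommGroup V) (_ : NormedSpace ℝ V)
        (_ : CompleteSpace V) (σ : LinNonexpAction S V) (f : X → V),
        Isometry f ∧ ∀ s x, f (π.act s x) = σ.act s (f x)) ↔
      ∀ x : X, IsBounded (range fun s => π.act s x) := by
  refine ⟨?_, stmt_3_mpr π⟩
  rintro ⟨V, _, _, _, σ, f, hf, he⟩ x
  rw [Metric.isBounded_iff]
  refine ⟨‖f x‖ + ‖f x‖, ?_⟩
  rintro _ ⟨s, rfl⟩ _ ⟨t, rfl⟩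
  rw [← hf.dist_eq, he, he, dist_eq_norm]
  exact (norm_sub_le _ _).trans (add_le_add (σ.nonexp _ _) (σ.nonexp _ _))
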